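/- arXiv:math/0606428 — 2 statements merged into one kernel-verified Lean document; each statement's English description precedes it below -/
import Mathlib

section
/- Let z : ℝ × [0,T) → ℂ \ {0} be a smooth solution of the equivariant flow (*), 2π-periodic and regular in φ for each t. Then r = |z| and ⟨ν,e_r⟩ satisfy the evolution equations: ∂_t r = Δr + ((n−1)/r)·⟨∇r, e_r⟩ − (1/r)·⟨ν,e_r⟩² − (n−1)/r, and ∂_t ⟨ν,e_r⟩ = Δ⟨ν,e_r⟩ + ((n−1)/r)·⟨∇⟨ν,e_r⟩, e_r⟩ − (2n/r²)·⟨ν,e_r⟩·(1 − ⟨ν,e_r⟩²) + ( k − ⟨ν,e_r⟩/r )²·⟨ν,e_r⟩, where ⟨∇h, e_r⟩ := (∂_φ h)(∂_φ r)/g. -/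
open Real Set

/-- Euclidean inner product on ℂ ≅ ℝ²: ⟨a,b⟩ = Re(conj a · b). -/
noncomputable def ip (a b : ℂ) : ℝ := a.re * b.re + a.im * b.im

/-- Outward unit normal ν = (∂_φ v − i ∂_φ u)/√g of a regular curve z = u + iv. -/
noncomputable def nu (z : ℝ → ℂ) (φ : ℝ) : ℂ :=
  (‖deriv z φ‖)⁻¹ • (⟨(deriv z φ).im, -(deriv z φ).re⟩ : ℂ)

/-- Curvature k = (u'v'' − v'u'')/g^{3/2}. -/
noncomputable def curv (z : ℝ → ℂ) (φ : ℝ) : ℝ :=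
  ((deriv z φ).re * (deriv (deriv z) φ).im -
    (deriv z φ).im * (deriv (deriv z) φ).re) / ‖deriv z φ‖ ^ 3

/-- f = k + (n−1)⟨z,ν⟩/|z|². -/
noncomputable def fq (n : ℕ) (z : ℝ → ℂ) (φ : ℝ) : ℝ :=
  curv z φ + ((n : ℝ) - 1) * ip (z φ) (nu z φ) / ‖z φ‖ ^ 2

/-- Tangential Laplacian Δh = (1/√g)∂_φ(∂_φ h/√g) along the curve z. -/
noncomputable def lap (z : ℝ → ℂ) (h : ℝ → ℝ) (φ : ℝ) : ℝ :=
  (deriv (fun ψ => deriv h ψ / ‖deriv z ψ‖) φ) / ‖deriv z φ‖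

/-- ⟨ν, e_r⟩ = ⟨z,ν⟩/|z|. -/
noncomputable def ner (z : ℝ → ℂ) (φ : ℝ) : ℝ := ip (z φ) (nu z φ) / ‖z φ‖

lemma ip_self (a : ℂ) : ip a a = ‖a‖ ^ 2 := by
  rw [← Complex.normSq_eq_norm_sq, Complex.normSq_apply, ip]

lemma hasDerivAt_ip {a b : ℝ → ℂ} {a' b' : ℂ} {x : ℝ}
    (ha : HasDerivAt a a' x) (hb : HasDerivAt b b' x) :
    HasDerivAt (fun y => ip (a y) (b y)) (ip a' (b x) + ip (a x) b') x := by
  have hre {c : ℝ → ℂ} {c' : ℂ} (hc : HasDerivAt c c' x) :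
      HasDerivAt (fun y => (c y).re) c'.re x :=
    Complex.reCLM.hasFDerivAt.comp_hasDerivAt x hc
  have him {c : ℝ → ℂ} {c' : ℂ} (hc : HasDerivAt c c' x) :
      HasDerivAt (fun y => (c y).im) c'.im x :=
    Complex.imCLM.hasFDerivAt.comp_hasDerivAt x hc
  refine (((hre ha).mul (hre hb)).add ((him ha).mul (him hb))).congr_deriv ?_
  simp only [ip]
  ring

lemma hasDerivAt_norm_of_ne_zero {a : ℝ → ℂ} {a' : ℂ} {x : ℝ}
    (ha : HasDerivAt a a' x) (h0 : a x ≠ 0) :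
    HasDerivAt (fun y => ‖a y‖) (ip (a x) a' / ‖a x‖) x := by
  have hsq (y : ℝ) : ‖a y‖ = √(ip (a y) (a y)) := by
    rw [ip_self, Real.sqrt_sq (norm_nonneg _)]
  have hne : ip (a x) (a x) ≠ 0 := by
    rw [ip_self]
    exact pow_ne_zero 2 (norm_ne_zero_iff.mpr h0)
  have h := (hasDerivAt_ip ha ha).sqrt hne
  rw [← hsq] at h
  simp only [hsq] at h ⊢
  refine h.congr_deriv ?_
  rw [← hsq]
  have : ‖a x‖ ≠ 0 := norm_ne_zero_iff.mpr h0
  simp only [ip]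
  field_simp
  ring

/-- Rotation by `-π/2`, which turns a tangent vector into an outward normal. -/
def rotNeg (w : ℂ) : ℂ := ⟨w.im, -w.re⟩

lemma rotNeg_eq (w : ℂ) : rotNeg w = -Complex.I * w := by
  apply Complex.ext <;> simp [rotNeg]

lemma hasDerivAt_rotNeg {a : ℝ → ℂ} {a' : ℂ} {x : ℝ} (ha : HasDerivAt a a' x) :
    HasDerivAt (fun y => rotNeg (a y)) (rotNeg a') x := by
  simp only [rotNeg_eq]
  exact ha.const_mul _

lemma nu_eq (z : ℝ → ℂ) (φ : ℝ) : nu z φ = ‖deriv z φ‖⁻¹ • rotNeg (deriv z φ) := rfl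

/-- The derivative of a normalized rotated vector. -/
lemma hasDerivAt_inv_norm_smul_rotNeg {w : ℝ → ℂ} {w' : ℂ} {x : ℝ}
    (hw : HasDerivAt w w' x) (h0 : w x ≠ 0) :
    HasDerivAt (fun y => ‖w y‖⁻¹ • rotNeg (w y))
      ((((w x).re * w'.im - (w x).im * w'.re) / ‖w x‖ ^ 3) • w x) x := by
  have hG : ‖w x‖ ≠ 0 := norm_ne_zero_iff.mpr h0
  have hsq : (w x).re * (w x).re + (w x).im * (w x).im = ‖w x‖ ^ 2 := ip_self (w x)
  refine (((hasDerivAt_norm_of_ne_zero hw h0).inv hG).smul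
    (hasDerivAt_rotNeg hw)).congr_deriv ?_
  apply Complex.ext
  · simp only [rotNeg, ip, Pi.inv_apply, Complex.add_re, Complex.smul_re, smul_eq_mul]
    field_simp
    rw [← hsq]
    ring
  · simp only [rotNeg, ip, Pi.inv_apply, Complex.add_im, Complex.smul_im, smul_eq_mul]
    field_simp
    rw [← hsq]
    ring

/-- The tangential counterpart `⟨τ, e_r⟩` of `ner`. -/
noncomputable def tauEr (z : ℝ → ℂ) (φ : ℝ) : ℝ :=
  ip (z φ) (deriv z φ) / (‖deriv z φ‖ * ‖z φ‖)

section Curve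

variable {z : ℝ → ℂ} {φ : ℝ}

lemma ner_sq_add_tauEr_sq (hreg : deriv z φ ≠ 0) (hnz : z φ ≠ 0) :
    ner z φ ^ 2 + tauEr z φ ^ 2 = 1 := by
  have hG : ‖deriv z φ‖ ≠ 0 := norm_ne_zero_iff.mpr hreg
  have hr : ‖z φ‖ ≠ 0 := norm_ne_zero_iff.mpr hnz
  have hG2 := ip_self (deriv z φ)
  have hr2 := ip_self (z φ)
  simp only [ner, nu_eq, tauEr]
  generalize ‖deriv z φ‖ = G at *
  generalize ‖z φ‖ = r at *
  simp only [ip, rotNeg, Complex.smul_re, Complex.smul_im, smul_eq_mul] at *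
  field_simp
  rw [← hG2, ← hr2]
  ring

lemma hasDerivAt_nu (hsm : ContDiff ℝ (⊤ : ℕ∞) z) (hreg : deriv z φ ≠ 0) :
    HasDerivAt (nu z) (curv z φ • deriv z φ) φ := by
  have h2 : HasDerivAt (deriv z) (deriv (deriv z) φ) φ :=
    (hsm.iterate_deriv 1).differentiable (by simp) |>.differentiableAt.hasDerivAt
  exact hasDerivAt_inv_norm_smul_rotNeg h2 hreg

lemma hasDerivAt_norm_curve (hz : DifferentiableAt ℝ z φ) (hreg : deriv z φ ≠ 0)
    (hnz : z φ ≠ 0) :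
    HasDerivAt (fun ψ => ‖z ψ‖) (‖deriv z φ‖ * tauEr z φ) φ := by
  have hG : ‖deriv z φ‖ ≠ 0 := norm_ne_zero_iff.mpr hreg
  refine (hasDerivAt_norm_of_ne_zero hz.hasDerivAt hnz).congr_deriv ?_
  rw [tauEr]
  field_simp

lemma ip_deriv_nu : ip (deriv z φ) (nu z φ) = 0 := by
  simp only [ip, nu_eq, rotNeg, Complex.smul_re, Complex.smul_im, smul_eq_mul]
  ring

lemma ip_smul_right (a b : ℂ) (c : ℝ) : ip a (c • b) = c * ip a b := by
  simp only [ip, Complex.smul_re, Complex.smul_im, smul_eq_mul]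
  ring

lemma ip_smul_left (a b : ℂ) (c : ℝ) : ip (c • a) b = c * ip a b := by
  simp only [ip, Complex.smul_re, Complex.smul_im, smul_eq_mul]
  ring

lemma ip_nu_nu (hreg : deriv z φ ≠ 0) : ip (nu z φ) (nu z φ) = 1 := by
  have hG : ‖deriv z φ‖ ≠ 0 := norm_ne_zero_iff.mpr hreg
  have hG2 := ip_self (deriv z φ)
  simp only [ip, nu_eq, rotNeg, Complex.smul_re, Complex.smul_im, smul_eq_mul] at *
  field_simp
  linarith

lemma ip_nu_eq (hnz : z φ ≠ 0) : ip (z φ) (nu z φ) = ner z φ * ‖z φ‖ := by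
  rw [ner, div_mul_cancel₀ _ (norm_ne_zero_iff.mpr hnz)]

lemma ip_deriv_eq (hreg : deriv z φ ≠ 0) (hnz : z φ ≠ 0) :
    ip (z φ) (deriv z φ) = tauEr z φ * (‖deriv z φ‖ * ‖z φ‖) := by
  rw [tauEr, div_mul_cancel₀]
  exact mul_ne_zero (norm_ne_zero_iff.mpr hreg) (norm_ne_zero_iff.mpr hnz)

lemma hasDerivAt_ner (hsm : ContDiff ℝ (⊤ : ℕ∞) z) (hreg : deriv z φ ≠ 0) (hnz : z φ ≠ 0) :
    HasDerivAt (ner z)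
      (‖deriv z φ‖ * (tauEr z φ * (curv z φ - ner z φ / ‖z φ‖))) φ := by
  have hr : ‖z φ‖ ≠ 0 := norm_ne_zero_iff.mpr hnz
  have hz : DifferentiableAt ℝ z φ := hsm.differentiable (by simp) φ
  refine ((hasDerivAt_ip hz.hasDerivAt (hasDerivAt_nu hsm hreg)).div
    (hasDerivAt_norm_curve hz hreg hnz) hr).congr_deriv ?_
  rw [ip_deriv_nu, ip_smul_right, ip_nu_eq hnz, ip_deriv_eq hreg hnz]
  field_simp
  ring

lemma differentiableAt_curv (hsm : ContDiff ℝ (⊤ : ℕ∞) z) (hreg : deriv z φ ≠ 0) :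
    DifferentiableAt ℝ (curv z) φ := by
  have h1 : DifferentiableAt ℝ (deriv z) φ :=
    (hsm.iterate_deriv 1).differentiable (by simp) φ
  have h2 : DifferentiableAt ℝ (deriv (deriv z)) φ :=
    (hsm.iterate_deriv 2).differentiable (by simp) φ
  have hG : ‖deriv z φ‖ ^ 3 ≠ 0 := pow_ne_zero 3 (norm_ne_zero_iff.mpr hreg)
  have hre {c : ℝ → ℂ} (hc : DifferentiableAt ℝ c φ) :
      DifferentiableAt ℝ (fun y => (c y).re) φ :=
    Complex.reCLM.differentiableAt.comp φ hc
  have him {c : ℝ → ℂ} (hc : DifferentiableAt ℝ c φ) :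
      DifferentiableAt ℝ (fun y => (c y).im) φ :=
    Complex.imCLM.differentiableAt.comp φ hc
  exact (((hre h1).mul (him h2)).sub ((him h1).mul (hre h2))).div
    ((hasDerivAt_norm_of_ne_zero h1.hasDerivAt hreg).differentiableAt.pow 3) hG

lemma hasDerivAt_tauEr (hsm : ContDiff ℝ (⊤ : ℕ∞) z) (hreg : deriv z φ ≠ 0) (hnz : z φ ≠ 0) :
    HasDerivAt (tauEr z)
      (-(‖deriv z φ‖ * (ner z φ * (curv z φ - ner z φ / ‖z φ‖)))) φ := by
  have hr : ‖z φ‖ ≠ 0 := norm_ne_zero_iff.mpr hnz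
  have hG : ‖deriv z φ‖ ≠ 0 := norm_ne_zero_iff.mpr hreg
  have hz : DifferentiableAt ℝ z φ := hsm.differentiable (by simp) φ
  have h1 : DifferentiableAt ℝ (deriv z) φ :=
    (hsm.iterate_deriv 1).differentiable (by simp) φ
  refine ((hasDerivAt_ip hz.hasDerivAt h1.hasDerivAt).div
    ((hasDerivAt_norm_of_ne_zero h1.hasDerivAt hreg).mul
      (hasDerivAt_norm_curve hz hreg hnz)) (mul_ne_zero hG hr)).congr_deriv ?_
  have hG2 := ip_self (deriv z φ)
  have hr2 := ip_self (z φ)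
  simp only [ner, nu_eq, tauEr, curv, Pi.mul_apply]
  generalize ‖deriv z φ‖ = G at *
  generalize ‖z φ‖ = r at *
  generalize deriv (deriv z) φ = a at *
  generalize deriv z φ = w at *
  generalize z φ = c at *
  simp only [ip, rotNeg, Complex.smul_re, Complex.smul_im, smul_eq_mul] at *
  field_simp
  linear_combination -(c.re * a.re + c.im * a.im) * r ^ 2 * hG2 -
    G ^ 2 * (w.re * w.re + w.im * w.im) * hr2

lemma lap_norm (hsm : ContDiff ℝ (⊤ : ℕ∞) z) (hreg : ∀ ψ, deriv z ψ ≠ 0)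
    (hnz : ∀ ψ, z ψ ≠ 0) :
    lap z (fun ψ => ‖z ψ‖) φ = -(ner z φ * (curv z φ - ner z φ / ‖z φ‖)) := by
  have hG : ‖deriv z φ‖ ≠ 0 := norm_ne_zero_iff.mpr (hreg φ)
  have h : (fun ψ => deriv (fun ψ => ‖z ψ‖) ψ / ‖deriv z ψ‖) = tauEr z := by
    funext ψ
    rw [(hasDerivAt_norm_curve (hsm.differentiable (by simp) ψ) (hreg ψ) (hnz ψ)).deriv,
      mul_div_cancel_left₀ _ (norm_ne_zero_iff.mpr (hreg ψ))]
  rw [lap, h, (hasDerivAt_tauEr hsm (hreg φ) (hnz φ)).deriv]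
  field_simp

lemma lap_ner (hsm : ContDiff ℝ (⊤ : ℕ∞) z) (hreg : ∀ ψ, deriv z ψ ≠ 0)
    (hnz : ∀ ψ, z ψ ≠ 0) :
    lap z (ner z) φ = -(ner z φ * (curv z φ - ner z φ / ‖z φ‖) ^ 2) +
      tauEr z φ * (deriv (curv z) φ / ‖deriv z φ‖ -
        tauEr z φ * (curv z φ - ner z φ / ‖z φ‖) / ‖z φ‖ +
        ner z φ * tauEr z φ / ‖z φ‖ ^ 2) := by
  have hG : ‖deriv z φ‖ ≠ 0 := norm_ne_zero_iff.mpr (hreg φ)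
  have hr : ‖z φ‖ ≠ 0 := norm_ne_zero_iff.mpr (hnz φ)
  have h : (fun ψ => deriv (ner z) ψ / ‖deriv z ψ‖) =
      fun ψ => tauEr z ψ * (curv z ψ - ner z ψ / ‖z ψ‖) := by
    funext ψ
    rw [(hasDerivAt_ner hsm (hreg ψ) (hnz ψ)).deriv,
      mul_div_cancel_left₀ _ (norm_ne_zero_iff.mpr (hreg ψ))]
  have hd := (hasDerivAt_tauEr hsm (hreg φ) (hnz φ)).mul
    ((differentiableAt_curv hsm (hreg φ)).hasDerivAt.sub
      ((hasDerivAt_ner hsm (hreg φ) (hnz φ)).div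
        (hasDerivAt_norm_curve (hsm.differentiable (by simp) φ) (hreg φ) (hnz φ)) hr))
  rw [lap, h]
  erw [hd.deriv]
  simp only [Pi.sub_apply, Pi.div_apply]
  field_simp
  ring

lemma hasDerivAt_fq (n : ℕ) (hsm : ContDiff ℝ (⊤ : ℕ∞) z) (hreg : deriv z φ ≠ 0)
    (hnz : ∀ ψ, z ψ ≠ 0) :
    HasDerivAt (fq n z) (deriv (curv z) φ + ((n : ℝ) - 1) *
      (‖deriv z φ‖ * (tauEr z φ * (curv z φ - ner z φ / ‖z φ‖)) / ‖z φ‖ -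
        ner z φ * (‖deriv z φ‖ * tauEr z φ) / ‖z φ‖ ^ 2)) φ := by
  have hr : ‖z φ‖ ≠ 0 := norm_ne_zero_iff.mpr (hnz φ)
  have h : fq n z = fun ψ => curv z ψ + ((n : ℝ) - 1) * (ner z ψ / ‖z ψ‖) := by
    funext ψ
    rw [fq, ner]
    ring
  rw [h]
  refine ((differentiableAt_curv hsm hreg).hasDerivAt.add
    (((hasDerivAt_ner hsm hreg (hnz φ)).div
      (hasDerivAt_norm_curve (hsm.differentiable (by simp) φ) hreg (hnz φ)) hr).const_mul
        ((n : ℝ) - 1))).congr_deriv ?_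
  field_simp

end Curve

/-- Equality of mixed partial derivatives for a smooth map of two real variables. -/
lemma hasDerivAt_deriv_swap {z : ℝ → ℝ → ℂ}
    (hsm : ContDiff ℝ (⊤ : ℕ∞) (fun p : ℝ × ℝ => z p.1 p.2)) (t φ : ℝ) :
    HasDerivAt (fun s => deriv (z s) φ) (deriv (fun ψ => deriv (fun s => z s ψ) t) φ) t := by
  let F : ℝ × ℝ → ℂ := fun p => z p.1 p.2
  have hdF (p : ℝ × ℝ) : HasFDerivAt F (fderiv ℝ F p) p :=
    (hsm.differentiable (by simp) p).hasFDerivAt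
  have hddF (p : ℝ × ℝ) : HasFDerivAt (fderiv ℝ F) (fderiv ℝ (fderiv ℝ F) p) p :=
    ((hsm.fderiv_right (m := 1) (by norm_cast)).differentiable (by simp) p).hasFDerivAt
  have hl (s ψ : ℝ) : HasDerivAt (fun s => (s, ψ)) ((1, 0) : ℝ × ℝ) s :=
    (hasDerivAt_id s).prodMk (hasDerivAt_const s ψ)
  have hr (s ψ : ℝ) : HasDerivAt (fun ψ => (s, ψ)) ((0, 1) : ℝ × ℝ) ψ :=
    (hasDerivAt_const ψ s).prodMk (hasDerivAt_id ψ)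
  have h1 (s ψ : ℝ) : deriv (z s) ψ = fderiv ℝ F (s, ψ) (0, 1) :=
    (HasFDerivAt.comp_hasDerivAt (f := fun ψ => (s, ψ)) ψ (hdF (s, ψ)) (hr s ψ)).deriv
  have h2 (s ψ : ℝ) : deriv (fun s => z s ψ) s = fderiv ℝ F (s, ψ) (1, 0) :=
    (HasFDerivAt.comp_hasDerivAt (f := fun s => (s, ψ)) s (hdF (s, ψ)) (hl s ψ)).deriv
  have h3 : HasDerivAt (fun ψ => fderiv ℝ F (t, ψ) (1, 0))
      (fderiv ℝ (fderiv ℝ F) (t, φ) (0, 1) (1, 0)) φ :=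
    (ContinuousLinearMap.apply ℝ ℂ ((1, 0) : ℝ × ℝ)).hasFDerivAt.comp_hasDerivAt φ
      (HasFDerivAt.comp_hasDerivAt (f := fun ψ => (t, ψ)) φ (hddF (t, φ)) (hr t φ))
  have h4 : HasDerivAt (fun s => fderiv ℝ F (s, φ) (0, 1))
      (fderiv ℝ (fderiv ℝ F) (t, φ) (1, 0) (0, 1)) t :=
    (ContinuousLinearMap.apply ℝ ℂ ((0, 1) : ℝ × ℝ)).hasFDerivAt.comp_hasDerivAt t
      (HasFDerivAt.comp_hasDerivAt (f := fun s => (s, φ)) t (hddF (t, φ)) (hl t φ))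
  simp only [h1, h2]
  rw [h3.deriv, ← second_derivative_symmetric hdF (hddF (t, φ)) (1, 0) (0, 1)]
  exact h4

/-- Evolution equations for r = |z| and ⟨ν,e_r⟩ under the equivariant flow:
∂_t r = Δr + ((n−1)/r)⟨∇r,e_r⟩ − (1/r)⟨ν,e_r⟩² − (n−1)/r, and
∂_t⟨ν,e_r⟩ = Δ⟨ν,e_r⟩ + ((n−1)/r)⟨∇⟨ν,e_r⟩,e_r⟩ − (2n/r²)⟨ν,e_r⟩(1−⟨ν,e_r⟩²)
  + (k − ⟨ν,e_r⟩/r)²⟨ν,e_r⟩, where ⟨∇h,e_r⟩ = (∂_φ h)(∂_φ r)/g. -/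
theorem evolution_r_and_ner (n : ℕ) (hn : 1 ≤ n) (T : ℝ) (z : ℝ → ℝ → ℂ)
    (hsm : ContDiff ℝ (⊤ : ℕ∞) (fun p : ℝ × ℝ => z p.1 p.2))
    (hper : ∀ t φ, z t (φ + 2 * π) = z t φ)
    (hreg : ∀ t ∈ Ico (0:ℝ) T, ∀ φ, deriv (z t) φ ≠ 0)
    (hnz : ∀ t ∈ Ico (0:ℝ) T, ∀ φ, z t φ ≠ 0)
    (hflow : ∀ t ∈ Ico (0:ℝ) T, ∀ φ,
      deriv (fun s => z s φ) t = -(fq n (z t) φ) • nu (z t) φ) :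
    ∀ t ∈ Ico (0:ℝ) T, ∀ φ : ℝ,
      (deriv (fun s => ‖z s φ‖) t =
        lap (z t) (fun ψ => ‖z t ψ‖) φ +
        ((n : ℝ) - 1) / ‖z t φ‖ *
          (deriv (fun ψ => ‖z t ψ‖) φ * deriv (fun ψ => ‖z t ψ‖) φ / ‖deriv (z t) φ‖ ^ 2) -
        (1 / ‖z t φ‖) * (ner (z t) φ) ^ 2 - ((n : ℝ) - 1) / ‖z t φ‖) ∧
      (deriv (fun s => ner (z s) φ) t =
        lap (z t) (ner (z t)) φ +
        ((n : ℝ) - 1) / ‖z t φ‖ *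
          (deriv (ner (z t)) φ * deriv (fun ψ => ‖z t ψ‖) φ / ‖deriv (z t) φ‖ ^ 2) -
        (2 * (n : ℝ) / ‖z t φ‖ ^ 2) * ner (z t) φ * (1 - (ner (z t) φ) ^ 2) +
        (curv (z t) φ - ner (z t) φ / ‖z t φ‖) ^ 2 * ner (z t) φ) := by
  intro t ht φ
  have hF : ContDiff ℝ (⊤ : ℕ∞) (z t) := hsm.comp (contDiff_const.prodMk contDiff_id)
  have hregφ := hreg t ht φ
  have hnzφ := hnz t ht φ
  have hG : ‖deriv (z t) φ‖ ≠ 0 := norm_ne_zero_iff.mpr hregφ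
  have hr : ‖z t φ‖ ≠ 0 := norm_ne_zero_iff.mpr hnzφ
  have hzt : HasDerivAt (fun s => z s φ) (-(fq n (z t) φ) • nu (z t) φ) t := by
    rw [← hflow t ht φ]
    have : ContDiff ℝ (⊤ : ℕ∞) (fun s => z s φ) := hsm.comp (contDiff_id.prodMk contDiff_const)
    exact (this.differentiable (by simp) t).hasDerivAt
  have hnu := hasDerivAt_nu hF hregφ
  have hwt := hasDerivAt_deriv_swap hsm t φ
  have hfun : (fun ψ => deriv (fun s => z s ψ) t) =
      fun ψ => -(fq n (z t) ψ) • nu (z t) ψ := funext (hflow t ht)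
  rw [hfun] at hwt
  obtain ⟨f', hf', hfq⟩ : ∃ f', f' = _ ∧ HasDerivAt (fq n (z t)) f' φ :=
    ⟨_, rfl, hasDerivAt_fq n hF hregφ (hnz t ht)⟩
  rw [HasDerivAt.deriv (f := fun ψ => -(fq n (z t) ψ) • nu (z t) ψ) (hfq.neg.smul hnu)] at hwt
  have hrt := hasDerivAt_norm_of_ne_zero hzt hnzφ
  have hnut : HasDerivAt (fun s => nu (z s) φ)
      ((f' / ‖deriv (z t) φ‖ ^ 2) • deriv (z t) φ) t := by
    refine (hasDerivAt_inv_norm_smul_rotNeg hwt hregφ).congr_deriv ?_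
    congr 1
    have hG2 := ip_self (deriv (z t) φ)
    simp only [ip, nu_eq, rotNeg, Complex.add_re, Complex.add_im, Complex.smul_re,
      Complex.smul_im, smul_eq_mul] at hG2 ⊢
    field_simp
    linear_combination f' * hG2
  have hnert : HasDerivAt (fun s => ner (z s) φ) _ t := (hasDerivAt_ip hzt hnut).div hrt hr
  have hrφ := (hasDerivAt_norm_curve (hF.differentiable (by simp) φ) hregφ hnzφ).deriv
  have hpq := ner_sq_add_tauEr_sq hregφ hnzφ
  have hfq_eq : fq n (z t) φ = curv (z t) φ + ((n : ℝ) - 1) * (ner (z t) φ / ‖z t φ‖) := by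
    rw [fq, ner]
    ring
  constructor
  · rw [hrt.deriv, lap_norm hF (hreg t ht) (hnz t ht), hrφ, ip_smul_right, ip_nu_eq hnzφ, hfq_eq]
    have hq : tauEr (z t) φ ^ 2 = 1 - ner (z t) φ ^ 2 := by linarith
    field_simp
    rw [hq]
    ring
  · rw [lap_ner hF (hreg t ht) (hnz t ht), hrφ, (hasDerivAt_ner hF hregφ hnzφ).deriv]
    rw [hnert.deriv, ip_smul_left, ip_smul_right, ip_smul_right, ip_nu_nu hregφ,
      ip_nu_eq hnzφ, ip_deriv_eq hregφ hnzφ, hf', hfq_eq]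
    field_simp
    linear_combination ‖deriv (z t) φ‖ *
      (curv (z t) φ * ‖z t φ‖ - ((n : ℝ) + 1) * ner (z t) φ) * hpq
end

section
/- Let z : ℝ × [0,T) → ℂ \ {0} be a smooth solution of the equivariant flow (*), 2π-periodic and regular in φ for each t. If the initial curve is starshaped, i.e. ⟨ν,e_r⟩(φ,0) > 0 for all φ, then ⟨ν,e_r⟩(φ,t) > 0 for all φ ∈ ℝ and all t ∈ [0,T). -/
open Real Set

open Filter Topology

/-- A function with a minimum at a point has nonnegative second derivative there. -/
lemma deriv_deriv_nonneg_of_isLocalMin {h : ℝ → ℝ} {x : ℝ} (hc : ContinuousAt h x)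
    (hmin : IsLocalMin h x) : 0 ≤ deriv (deriv h) x := by
  by_contra! hneg
  have hmax : IsLocalMax h x :=
    isLocalMax_of_deriv_deriv_neg hneg hmin.deriv_eq_zero hc
  have hconst : h =ᶠ[𝓝 x] fun _ => h x := by
    filter_upwards [hmin, hmax] with y h1 h2 using le_antisymm h2 h1
  have h2 := hconst.deriv.deriv_eq
  simp at h2
  exact hneg.ne h2

/-- A function that dominates its value at `x` on a left neighbourhood has nonpositive derivative
at `x`. -/
lemma HasDerivAt.nonpos_of_forall_lt {h : ℝ → ℝ} {a x h' : ℝ} (hax : a < x)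
    (hd : HasDerivAt h h' x) (hle : ∀ s, a < s → s < x → h x ≤ h s) : h' ≤ 0 := by
  have ht := (hasDerivAt_iff_tendsto_slope.mp hd).mono_left
    (nhdsWithin_mono x (fun y (hy : y ∈ Iio x) => (mem_Iio.1 hy).ne))
  refine le_of_tendsto ht ?_
  filter_upwards [Ioo_mem_nhdsLT hax] with s hs
  rw [slope_def_field]
  exact div_nonpos_of_nonneg_of_nonpos (sub_nonneg.2 (hle s hs.1 hs.2)) (sub_nonpos.2 hs.2.le)

/-- Parabolic minimum principle: if `W` is periodic in space, initially positive, and satisfies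
`∂ₜ W > -C W` wherever it is positive with vanishing first and nonnegative second space derivative, then it stays positive. -/
lemma pos_of_periodic_parabolic {W Wt : ℝ → ℝ → ℝ} {t₀ C P : ℝ} (hP : 0 < P)
    (hW : Continuous fun p : ℝ × ℝ => W p.1 p.2)
    (hper : ∀ t, Function.Periodic (W t) P)
    (hWt : ∀ t φ, HasDerivAt (fun s => W s φ) (Wt t φ) t)
    (h0 : ∀ φ, 0 < W 0 φ)
    (hineq : ∀ t ∈ Ioc 0 t₀, ∀ φ ∈ Icc 0 P, 0 < W t φ → deriv (W t) φ = 0 →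
      0 ≤ deriv (deriv (W t)) φ → -C * W t φ < Wt t φ) :
    ∀ t ∈ Icc 0 t₀, ∀ φ, 0 < W t φ := by
  have hWφ : ∀ t, Continuous (W t) := fun t => hW.comp (by fun_prop : Continuous fun φ => (t, φ))
  obtain ⟨φ₀, -, hφ₀⟩ := isCompact_Icc.exists_isMinOn (nonempty_Icc.2 hP.le) (hWφ 0).continuousOn
  have hred : ∀ φ, ∃ ψ ∈ Icc 0 P, ∀ t, W t φ = W t ψ := fun φ =>
    ⟨toIcoMod hP 0 φ, Ico_subset_Icc_self (by simpa using toIcoMod_mem_Ico hP 0 φ), fun t => by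
      rw [← self_sub_toIcoDiv_zsmul, (hper t).sub_zsmul_eq]⟩
  set m := W 0 φ₀ with hm
  have hm0 : 0 < m := h0 φ₀
  have hmle : ∀ φ, m ≤ W 0 φ := fun φ => by
    obtain ⟨ψ, hψ, he⟩ := hred φ
    rw [he]; exact hφ₀ hψ
  set V : ℝ → ℝ → ℝ := fun t φ => exp (C * t) * W t φ with hV
  have hVc : Continuous fun p : ℝ × ℝ => V p.1 p.2 := by
    simp only [hV]; fun_prop
  suffices hmain : ∀ t ∈ Icc 0 t₀, ∀ φ ∈ Icc 0 P, m / 2 < V t φ by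
    intro t ht φ
    obtain ⟨ψ, hψ, he⟩ := hred φ
    rw [he]
    exact pos_of_mul_pos_right ((half_pos hm0).trans (hmain t ht ψ hψ)) (exp_pos _).le
  by_contra! hcon
  obtain ⟨t', ht', φ', hφ', hle'⟩ := hcon
  have hK : IsCompact ((Icc 0 t₀ ×ˢ Icc 0 P) ∩ {p : ℝ × ℝ | V p.1 p.2 ≤ m / 2}) :=
    (isCompact_Icc.prod isCompact_Icc).inter_right (isClosed_le hVc continuous_const)
  obtain ⟨⟨t₁, φ₁⟩, ⟨⟨ht₁, hφ₁⟩, hle⟩, hfst⟩ :=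
    hK.exists_isMinOn ⟨(t', φ'), ⟨ht', hφ'⟩, hle'⟩ continuous_fst.continuousOn
  simp only [mem_ofPred_eq] at hle ht₁ hφ₁
  have hbefore : ∀ s, 0 ≤ s → s < t₁ → ∀ φ, m / 2 < V s φ := by
    intro s hs0 hs φ
    obtain ⟨ψ, hψ, he⟩ := hred φ
    simp only [hV, he]
    by_contra! hc
    have := hfst (a := (s, ψ)) ⟨⟨⟨hs0, hs.le.trans ht₁.2⟩, hψ⟩, hc⟩
    exact absurd hs (not_lt.2 this)
  have ht₁pos : 0 < t₁ := by
    refine lt_of_le_of_ne ht₁.1 fun h => ?_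
    rw [← h] at hle
    have := hmle φ₁
    simp only [hV, mul_zero, exp_zero, one_mul] at hle
    linarith
  have hat : ∀ φ, m / 2 ≤ V t₁ φ := fun φ => by
    have hcont : Continuous fun s => V s φ :=
      hVc.comp (by fun_prop : Continuous fun s => (s, φ))
    refine ge_of_tendsto (hcont.continuousAt.mono_left nhdsWithin_le_nhds : Tendsto _ (𝓝[<] t₁) _) ?_
    filter_upwards [Ioo_mem_nhdsLT ht₁pos] with s hs using (hbefore s hs.1.le hs.2 φ).le
  have hWmin : IsLocalMin (W t₁) φ₁ := Eventually.of_forall fun φ =>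
    le_of_mul_le_mul_left (hle.trans (hat φ)) (exp_pos (C * t₁))
  have hWpos : 0 < W t₁ φ₁ :=
    pos_of_mul_pos_right ((half_pos hm0).trans_le (hat φ₁)) (exp_pos _).le
  have hstrict := hineq t₁ ⟨ht₁pos, ht₁.2⟩ φ₁ hφ₁ hWpos hWmin.deriv_eq_zero
    (deriv_deriv_nonneg_of_isLocalMin (hWφ t₁).continuousAt hWmin)
  have hVd : HasDerivAt (fun s => V s φ₁)
      (exp (C * t₁) * (C * 1) * W t₁ φ₁ + exp (C * t₁) * Wt t₁ φ₁) t₁ :=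
    ((hasDerivAt_id t₁).const_mul C).exp.mul (hWt t₁ φ₁)
  have hnonpos := hVd.nonpos_of_forall_lt ht₁pos
    fun s h0s hs => hle.trans (hbefore s h0s.le hs φ₁).le
  have : 0 < exp (C * t₁) * (Wt t₁ φ₁ + C * W t₁ φ₁) := mul_pos (exp_pos _) (by linarith)
  linarith

section PartialDerivatives

variable {E : Type*} [NormedAddCommGroup E] [NormedSpace ℝ E] {a : ℝ → ℝ → E}

lemma hasDerivAt_snd_of_contDiff (ha : ContDiff ℝ (⊤ : ℕ∞) fun p : ℝ × ℝ => a p.1 p.2) (t φ : ℝ) :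
    HasDerivAt (a t) (fderiv ℝ (fun p : ℝ × ℝ => a p.1 p.2) (t, φ) (0, 1)) φ :=
  ((ha.differentiable (by simp)) (t, φ)).hasFDerivAt.comp_hasDerivAt φ
    ((hasDerivAt_const φ t).prodMk (hasDerivAt_id φ))

lemma hasDerivAt_fst_of_contDiff (ha : ContDiff ℝ (⊤ : ℕ∞) fun p : ℝ × ℝ => a p.1 p.2) (t φ : ℝ) :
    HasDerivAt (fun s => a s φ) (fderiv ℝ (fun p : ℝ × ℝ => a p.1 p.2) (t, φ) (1, 0)) t :=
  ((ha.differentiable (by simp)) (t, φ)).hasFDerivAt.comp_hasDerivAt (f := fun s => (s, φ)) t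
    ((hasDerivAt_id t).prodMk (hasDerivAt_const t φ))

lemma contDiff_deriv_snd (ha : ContDiff ℝ (⊤ : ℕ∞) fun p : ℝ × ℝ => a p.1 p.2) :
    ContDiff ℝ (⊤ : ℕ∞) fun p : ℝ × ℝ => deriv (a p.1) p.2 := by
  simp only [fun p : ℝ × ℝ => (hasDerivAt_snd_of_contDiff ha p.1 p.2).deriv]
  exact (ha.fderiv_right (by simp)).clm_apply contDiff_const

lemma contDiff_deriv_fst (ha : ContDiff ℝ (⊤ : ℕ∞) fun p : ℝ × ℝ => a p.1 p.2) :
    ContDiff ℝ (⊤ : ℕ∞) fun p : ℝ × ℝ => deriv (fun s => a s p.2) p.1 := by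
  simp only [fun p : ℝ × ℝ => (hasDerivAt_fst_of_contDiff ha p.1 p.2).deriv]
  exact (ha.fderiv_right (by simp)).clm_apply contDiff_const

/-- Mixed partial derivatives of a smooth function commute. -/
lemma deriv_deriv_comm_of_contDiff (ha : ContDiff ℝ (⊤ : ℕ∞) fun p : ℝ × ℝ => a p.1 p.2)
    (t φ : ℝ) :
    deriv (fun s => deriv (a s) φ) t = deriv (fun ψ => deriv (fun s => a s ψ) t) φ := by
  have hd : DifferentiableAt ℝ (fderiv ℝ fun p : ℝ × ℝ => a p.1 p.2) (t, φ) :=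
    ((ha.fderiv_right (m := (⊤ : ℕ∞)) (by simp)).differentiable (by simp)) (t, φ)
  have hsymm : IsSymmSndFDerivAt ℝ (fun p : ℝ × ℝ => a p.1 p.2) (t, φ) :=
    ha.contDiffAt.isSymmSndFDerivAt (by
      simpa using WithTop.coe_le_coe.2 (le_top : (2 : ℕ∞) ≤ ⊤))
  simp only [fun s ψ => (hasDerivAt_snd_of_contDiff ha s ψ).deriv,
    fun s ψ => (hasDerivAt_fst_of_contDiff ha s ψ).deriv]
  have h1 := (hd.hasFDerivAt.comp_hasDerivAt (f := fun s => (s, φ)) t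
    ((hasDerivAt_id t).prodMk (hasDerivAt_const t φ))).clm_apply
      (hasDerivAt_const t ((0 : ℝ), (1 : ℝ)))
  have h2 := (hd.hasFDerivAt.comp_hasDerivAt (f := fun ψ => (t, ψ)) φ
    ((hasDerivAt_const φ t).prodMk (hasDerivAt_id φ))).clm_apply
      (hasDerivAt_const φ ((1 : ℝ), (0 : ℝ)))
  have e1 := h1.deriv
  have e2 := h2.deriv
  simp only [map_zero, add_zero, Function.comp_def] at e1 e2
  exact e1.trans ((hsymm _ _).trans e2.symm)

end PartialDerivatives

/-- The zeroth order coefficient in the evolution equation of the unnormalized support function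
at critical points. -/
noncomputable def zerothCoeff (N u v u₁ v₁ u₂ v₂ u₃ v₃ : ℝ) : ℝ :=
  -2 * (-(u * u₁ + v * v₁) * (u₁ * u₂ + v₁ * v₂) + (u₁ * v₂ - v₁ * u₂) * (u * v₁ - v * u₁)) /
      ((u ^ 2 + v ^ 2) * (u₁ ^ 2 + v₁ ^ 2) ^ 2)
    - N / (u ^ 2 + v ^ 2) - (u₁ * u₃ + v₁ * v₃) / (u₁ ^ 2 + v₁ ^ 2) ^ 2
    + 4 * (u₁ * u₂ + v₁ * v₂) ^ 2 / (u₁ ^ 2 + v₁ ^ 2) ^ 3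
    - 2 * N * (u₁ * u₂ + v₁ * v₂) * (u * u₁ + v * v₁) /
      ((u₁ ^ 2 + v₁ ^ 2) ^ 2 * (u ^ 2 + v ^ 2))
    - 2 * N * (u * u₁ + v * v₁) ^ 2 / ((u₁ ^ 2 + v₁ ^ 2) * (u ^ 2 + v ^ 2) ^ 2)
    - (u₁ * u₂ + v₁ * v₂) ^ 2 / (u₁ ^ 2 + v₁ ^ 2) ^ 3
    - (u₁ * v₂ - v₁ * u₂) ^ 2 / (u₁ ^ 2 + v₁ ^ 2) ^ 3
    + N * ((u * u₁ + v * v₁) * (u₁ * u₂ + v₁ * v₂) - (u * v₁ - v * u₁) * (u₁ * v₂ - v₁ * u₂)) /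
      ((u₁ ^ 2 + v₁ ^ 2) ^ 2 * (u ^ 2 + v ^ 2))

/-- Algebraic core of the evolution equation of the unnormalized support function at a critical
point. -/
lemma evolution_aux {N g R W p q A A₁ B w₂ b₃ : ℝ} (hg : g ≠ 0) (hR : R ≠ 0)
    (hA : A * (R * g) = -W * B * p + A * W ^ 2) (hpA : A * p = -W * B)
    (hq : q = (p * B - W * A) / g) (hw₂ : w₂ = (p * A₁ + W * b₃) / g) :
    -(A / g ^ 2 + N * W / (g * R)) * g
      + (A₁ / g ^ 2 - 2 * A * (2 * B) / g ^ 3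
        - N * W * (2 * B) / (g ^ 2 * R) - N * W * (2 * p) / (g * R ^ 2)) * p
      + (A / g ^ 2 + N * W / (g * R)) * q
    = (A + w₂) / g +
      (-2 * (-p * B + A * W) / (R * g ^ 2) - N / R - b₃ / g ^ 2 + 4 * B ^ 2 / g ^ 3
      - 2 * N * B * p / (g ^ 2 * R) - 2 * N * p ^ 2 / (g * R ^ 2) - B ^ 2 / g ^ 3 - A ^ 2 / g ^ 3
      + N * (p * B - W * A) / (g ^ 2 * R)) * W := by
  subst hq hw₂
  have e : A / g = (-W * B * p + A * W ^ 2) / (R * g ^ 2) := by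
    field_simp; linarith
  have e2 : A * p / g^3 = -W * B / g^3 := by rw [hpA]
  have e3 : (A / g ^ 2 + N * W / (g * R)) * g = A / g + N * W / R := by field_simp
  linear_combination (-2) * e - e3  + (-4 * B+B) * e2

lemma evolution_at_critical_point {N u v u₁ v₁ u₂ v₂ u₃ v₃ : ℝ} (hg : u₁ ^ 2 + v₁ ^ 2 ≠ 0)
    (hR : u ^ 2 + v ^ 2 ≠ 0) (hcrit : u * v₂ - v * u₂ = 0) :
    -((u₁ * v₂ - v₁ * u₂) / (u₁ ^ 2 + v₁ ^ 2) ^ 2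
        + N * (u * v₁ - v * u₁) / ((u₁ ^ 2 + v₁ ^ 2) * (u ^ 2 + v ^ 2))) * (u₁ ^ 2 + v₁ ^ 2)
      + ((u₁ * v₃ - v₁ * u₃) / (u₁ ^ 2 + v₁ ^ 2) ^ 2
        - 2 * (u₁ * v₂ - v₁ * u₂) * (2 * (u₁ * u₂ + v₁ * v₂)) / (u₁ ^ 2 + v₁ ^ 2) ^ 3
        - N * (u * v₁ - v * u₁) * (2 * (u₁ * u₂ + v₁ * v₂)) /
          ((u₁ ^ 2 + v₁ ^ 2) ^ 2 * (u ^ 2 + v ^ 2))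
        - N * (u * v₁ - v * u₁) * (2 * (u * u₁ + v * v₁)) /
          ((u₁ ^ 2 + v₁ ^ 2) * (u ^ 2 + v ^ 2) ^ 2)) * (u * u₁ + v * v₁)
      + ((u₁ * v₂ - v₁ * u₂) / (u₁ ^ 2 + v₁ ^ 2) ^ 2
        + N * (u * v₁ - v * u₁) / ((u₁ ^ 2 + v₁ ^ 2) * (u ^ 2 + v ^ 2))) * (u * u₂ + v * v₂)
    = ((u₁ * v₂ - v₁ * u₂) + (u * v₃ - v * u₃)) / (u₁ ^ 2 + v₁ ^ 2)
      + zerothCoeff N u v u₁ v₁ u₂ v₂ u₃ v₃ * (u * v₁ - v * u₁) := by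
  have hpA : (u₁ * v₂ - v₁ * u₂) * (u * u₁ + v * v₁)
      = -(u * v₁ - v * u₁) * (u₁ * u₂ + v₁ * v₂) := by
    linear_combination (u₁ ^ 2 + v₁ ^ 2) * hcrit
  refine evolution_aux hg hR ?_ hpA ?_ ?_
  · linear_combination (u * u₁ + v * v₁) * hpA
  · rw [eq_div_iff hg]; ring
  · rw [eq_div_iff hg]; ring

/-- The quotient of the normal speed by the length element, as a rational function of the jet. -/
noncomputable def speedRatio (N u v u₁ v₁ u₂ v₂ : ℝ) : ℝ :=
  (u₁ * v₂ - v₁ * u₂) / (u₁ ^ 2 + v₁ ^ 2) ^ 2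
    + N * (u * v₁ - v * u₁) / ((u₁ ^ 2 + v₁ ^ 2) * (u ^ 2 + v ^ 2))

lemma hasDerivAt_speedRatio {N : ℝ} {u v u₁ v₁ u₂ v₂ : ℝ → ℝ} {u₃ v₃ φ : ℝ}
    (hg : u₁ φ ^ 2 + v₁ φ ^ 2 ≠ 0) (hR : u φ ^ 2 + v φ ^ 2 ≠ 0)
    (hcrit : u φ * v₂ φ - v φ * u₂ φ = 0)
    (hu : HasDerivAt u (u₁ φ) φ) (hv : HasDerivAt v (v₁ φ) φ)
    (hu₁ : HasDerivAt u₁ (u₂ φ) φ) (hv₁ : HasDerivAt v₁ (v₂ φ) φ)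
    (hu₂ : HasDerivAt u₂ u₃ φ) (hv₂ : HasDerivAt v₂ v₃ φ) :
    HasDerivAt (fun ψ => speedRatio N (u ψ) (v ψ) (u₁ ψ) (v₁ ψ) (u₂ ψ) (v₂ ψ))
      ((u₁ φ * v₃ - v₁ φ * u₃) / (u₁ φ ^ 2 + v₁ φ ^ 2) ^ 2
        - 2 * (u₁ φ * v₂ φ - v₁ φ * u₂ φ) * (2 * (u₁ φ * u₂ φ + v₁ φ * v₂ φ)) /
          (u₁ φ ^ 2 + v₁ φ ^ 2) ^ 3
        - N * (u φ * v₁ φ - v φ * u₁ φ) * (2 * (u₁ φ * u₂ φ + v₁ φ * v₂ φ)) /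
          ((u₁ φ ^ 2 + v₁ φ ^ 2) ^ 2 * (u φ ^ 2 + v φ ^ 2))
        - N * (u φ * v₁ φ - v φ * u₁ φ) * (2 * (u φ * u₁ φ + v φ * v₁ φ)) /
          ((u₁ φ ^ 2 + v₁ φ ^ 2) * (u φ ^ 2 + v φ ^ 2) ^ 2)) φ := by
  have hgd : HasDerivAt (fun ψ => u₁ ψ ^ 2 + v₁ ψ ^ 2)
      (2 * (u₁ φ * u₂ φ + v₁ φ * v₂ φ)) φ := by
    refine ((hu₁.fun_pow 2).fun_add (hv₁.fun_pow 2)).congr_deriv ?_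
    push_cast; ring
  have hRd : HasDerivAt (fun ψ => u ψ ^ 2 + v ψ ^ 2) (2 * (u φ * u₁ φ + v φ * v₁ φ)) φ := by
    refine ((hu.fun_pow 2).fun_add (hv.fun_pow 2)).congr_deriv ?_
    push_cast; ring
  have hWd : HasDerivAt (fun ψ => u ψ * v₁ ψ - v ψ * u₁ ψ) 0 φ := by
    refine ((hu.fun_mul hv₁).fun_sub (hv.fun_mul hu₁)).congr_deriv ?_
    linear_combination hcrit
  have hAd : HasDerivAt (fun ψ => u₁ ψ * v₂ ψ - v₁ ψ * u₂ ψ) (u₁ φ * v₃ - v₁ φ * u₃) φ := by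
    refine ((hu₁.fun_mul hv₂).fun_sub (hv₁.fun_mul hu₂)).congr_deriv ?_
    ring
  have h := (hAd.fun_div (hgd.fun_pow 2) (pow_ne_zero 2 hg)).fun_add
    ((hWd.const_mul N).fun_div (hgd.fun_mul hRd) (mul_ne_zero hg hR))
  refine h.congr_deriv ?_
  generalize 2 * (u₁ φ * u₂ φ + v₁ φ * v₂ φ) = g' at *
  generalize 2 * (u φ * u₁ φ + v φ * v₁ φ) = R' at *
  generalize u₁ φ ^ 2 + v₁ φ ^ 2 = g at *
  generalize u φ ^ 2 + v φ ^ 2 = R at *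
  field_simp
  push_cast
  ring

lemma HasDerivAt.complex_re {a : ℝ → ℂ} {a' : ℂ} {x : ℝ} (h : HasDerivAt a a' x) :
    HasDerivAt (fun y => (a y).re) a'.re x :=
  Complex.reCLM.hasFDerivAt.comp_hasDerivAt x h

lemma HasDerivAt.complex_im {a : ℝ → ℂ} {a' : ℂ} {x : ℝ} (h : HasDerivAt a a' x) :
    HasDerivAt (fun y => (a y).im) a'.im x :=
  Complex.imCLM.hasFDerivAt.comp_hasDerivAt x h

lemma norm_sq_eq_re_sq_add_im_sq (w : ℂ) : ‖w‖ ^ 2 = w.re ^ 2 + w.im ^ 2 := by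
  rw [Complex.sq_norm, Complex.normSq_apply]; ring

lemma re_sq_add_im_sq_ne_zero {w : ℂ} (hw : w ≠ 0) : w.re ^ 2 + w.im ^ 2 ≠ 0 := by
  rw [← norm_sq_eq_re_sq_add_im_sq]; exact pow_ne_zero 2 (norm_ne_zero_iff.2 hw)

lemma ip_nu (z : ℝ → ℂ) (φ : ℝ) :
    ip (z φ) (nu z φ)
      = ‖deriv z φ‖⁻¹ * ((z φ).re * (deriv z φ).im - (z φ).im * (deriv z φ).re) := by
  simp only [ip, nu, Complex.real_smul, Complex.re_ofReal_mul, Complex.im_ofReal_mul]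
  ring

lemma ner_pos_iff {z : ℝ → ℂ} {φ : ℝ} (hz : z φ ≠ 0) (hz' : deriv z φ ≠ 0) :
    0 < ner z φ ↔ 0 < (z φ).re * (deriv z φ).im - (z φ).im * (deriv z φ).re := by
  rw [ner, ip_nu, div_pos_iff_of_pos_right (norm_pos_iff.2 hz),
    mul_pos_iff_of_pos_left (inv_pos.2 (norm_pos_iff.2 hz'))]

lemma neg_fq_smul_nu (n : ℕ) {z : ℝ → ℂ} {φ : ℝ} (hz : z φ ≠ 0) (hz' : deriv z φ ≠ 0) :
    -(fq n z φ) • nu z φ =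
      -speedRatio (n - 1) (z φ).re (z φ).im (deriv z φ).re (deriv z φ).im
        (deriv (deriv z) φ).re (deriv (deriv z) φ).im •
        (⟨(deriv z φ).im, -(deriv z φ).re⟩ : ℂ) := by
  have h1 : ‖deriv z φ‖ ≠ 0 := norm_ne_zero_iff.2 hz'
  have h2 : ‖z φ‖ ≠ 0 := norm_ne_zero_iff.2 hz
  have h3 : ‖deriv z φ‖ ^ 2 ≠ 0 := pow_ne_zero 2 h1
  rw [nu, smul_smul, fq, ip_nu, curv, speedRatio, ← norm_sq_eq_re_sq_add_im_sq,
    ← norm_sq_eq_re_sq_add_im_sq]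
  congr 1
  field_simp

lemma continuousOn_zerothCoeff {X : Type*} [TopologicalSpace X] {s : Set X} (N : ℝ)
    {u v u₁ v₁ u₂ v₂ u₃ v₃ : X → ℝ} (hu : Continuous u) (hv : Continuous v)
    (hu₁ : Continuous u₁) (hv₁ : Continuous v₁) (hu₂ : Continuous u₂) (hv₂ : Continuous v₂)
    (hu₃ : Continuous u₃) (hv₃ : Continuous v₃)
    (hg : ∀ x ∈ s, u₁ x ^ 2 + v₁ x ^ 2 ≠ 0) (hR : ∀ x ∈ s, u x ^ 2 + v x ^ 2 ≠ 0) :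
    ContinuousOn (fun x => zerothCoeff N (u x) (v x) (u₁ x) (v₁ x) (u₂ x) (v₂ x) (u₃ x) (v₃ x))
      s := by
  unfold zerothCoeff
  intro x hx
  have h1 := hg x hx
  have h2 := hR x hx
  apply ContinuousAt.continuousWithinAt
  fun_prop (disch := simp_all)

lemma hasDerivAt_time_of_flow {n : ℕ} {z : ℝ → ℝ → ℂ} {t φ : ℝ}
    (hsm : ContDiff ℝ (⊤ : ℕ∞) (fun p : ℝ × ℝ => z p.1 p.2))
    (hreg : ∀ φ, deriv (z t) φ ≠ 0) (hnz : ∀ φ, z t φ ≠ 0)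
    (hflow : ∀ φ, deriv (fun s => z s φ) t = -(fq n (z t) φ) • nu (z t) φ)
    (hcrit : (z t φ).re * (deriv (deriv (z t)) φ).im
      - (z t φ).im * (deriv (deriv (z t)) φ).re = 0) :
    HasDerivAt (fun s => (z s φ).re * (deriv (z s) φ).im - (z s φ).im * (deriv (z s) φ).re)
      (((deriv (z t) φ).re * (deriv (deriv (z t)) φ).im
          - (deriv (z t) φ).im * (deriv (deriv (z t)) φ).re
        + ((z t φ).re * (deriv (deriv (deriv (z t))) φ).im
          - (z t φ).im * (deriv (deriv (deriv (z t))) φ).re)) /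
          ((deriv (z t) φ).re ^ 2 + (deriv (z t) φ).im ^ 2)
        + zerothCoeff (n - 1) (z t φ).re (z t φ).im (deriv (z t) φ).re (deriv (z t) φ).im
          (deriv (deriv (z t)) φ).re (deriv (deriv (z t)) φ).im
          (deriv (deriv (deriv (z t))) φ).re (deriv (deriv (deriv (z t))) φ).im
        * ((z t φ).re * (deriv (z t) φ).im - (z t φ).im * (deriv (z t) φ).re)) t := by
  have hsm₁ := contDiff_deriv_snd hsm
  have hsm₂ := contDiff_deriv_snd (a := fun t => deriv (z t)) hsm₁
  have hz := (hasDerivAt_snd_of_contDiff hsm t φ).differentiableAt.hasDerivAt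
  have hz₁ := (hasDerivAt_snd_of_contDiff (a := fun t => deriv (z t)) hsm₁ t
    φ).differentiableAt.hasDerivAt
  have hz₂ := (hasDerivAt_snd_of_contDiff (a := fun t => deriv (deriv (z t))) hsm₂ t
    φ).differentiableAt.hasDerivAt
  have ht := (hasDerivAt_fst_of_contDiff hsm t φ).differentiableAt.hasDerivAt
  have ht₁ := (hasDerivAt_fst_of_contDiff (a := fun t => deriv (z t)) hsm₁ t
    φ).differentiableAt.hasDerivAt
  have hg := re_sq_add_im_sq_ne_zero (hreg φ)
  have hR := re_sq_add_im_sq_ne_zero (hnz φ)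
  have hzt : ∀ ψ, deriv (fun s => z s ψ) t = _ :=
    fun ψ => (hflow ψ).trans (neg_fq_smul_nu n (hnz ψ) (hreg ψ))
  have hmix := (hasDerivAt_snd_of_contDiff (a := fun t φ => deriv (fun s => z s φ) t)
    (contDiff_deriv_fst hsm) t φ).differentiableAt.hasDerivAt
  rw [← deriv_deriv_comm_of_contDiff hsm] at hmix
  have hF := hasDerivAt_speedRatio (N := (n : ℝ) - 1) hg hR hcrit hz.complex_re hz.complex_im
    hz₁.complex_re hz₁.complex_im hz₂.complex_re hz₂.complex_im
  have hre := hmix.complex_re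
  have him := hmix.complex_im
  simp only [hzt, Complex.real_smul, Complex.re_ofReal_mul, Complex.im_ofReal_mul] at hre him
  have hre' := hre.unique (hF.fun_neg.fun_mul hz₁.complex_im)
  have him' := him.unique (hF.fun_neg.fun_mul hz₁.complex_re.fun_neg)
  refine ((ht.complex_re.fun_mul ht₁.complex_im).fun_sub
    (ht.complex_im.fun_mul ht₁.complex_re)).congr_deriv ?_
  rw [← evolution_at_critical_point hg hR hcrit, hre', him', hzt]
  simp only [Complex.real_smul, Complex.re_ofReal_mul, Complex.im_ofReal_mul, speedRatio]
  ring

/-- Starshapedness (⟨ν,e_r⟩ > 0) is preserved under the equivariant flow. -/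
theorem starshaped_preserved (n : ℕ) (hn : 1 ≤ n) (T : ℝ) (z : ℝ → ℝ → ℂ)
    (hsm : ContDiff ℝ (⊤ : ℕ∞) (fun p : ℝ × ℝ => z p.1 p.2))
    (hper : ∀ t φ, z t (φ + 2 * π) = z t φ)
    (hreg : ∀ t ∈ Ico (0:ℝ) T, ∀ φ, deriv (z t) φ ≠ 0)
    (hnz : ∀ t ∈ Ico (0:ℝ) T, ∀ φ, z t φ ≠ 0)
    (hflow : ∀ t ∈ Ico (0:ℝ) T, ∀ φ,
      deriv (fun s => z s φ) t = -(fq n (z t) φ) • nu (z t) φ)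
    (hstar : ∀ φ : ℝ, 0 < ner (z 0) φ) :
    ∀ t ∈ Ico (0:ℝ) T, ∀ φ : ℝ, 0 < ner (z t) φ := by
  intro t₀ ht₀
  have h0T : (0 : ℝ) ∈ Ico 0 T := ⟨le_rfl, ht₀.1.trans_lt ht₀.2⟩
  have hsub : ∀ t ∈ Icc 0 t₀, t ∈ Ico 0 T := fun t ht => ⟨ht.1, ht.2.trans_lt ht₀.2⟩
  have hsm₁ : ContDiff ℝ (⊤ : ℕ∞) fun p : ℝ × ℝ => deriv (z p.1) p.2 := contDiff_deriv_snd hsm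
  have hsm₂ : ContDiff ℝ (⊤ : ℕ∞) fun p : ℝ × ℝ => deriv (deriv (z p.1)) p.2 :=
    contDiff_deriv_snd (a := fun t => deriv (z t)) hsm₁
  have hsm₃ : ContDiff ℝ (⊤ : ℕ∞) fun p : ℝ × ℝ => deriv (deriv (deriv (z p.1))) p.2 :=
    contDiff_deriv_snd (a := fun t => deriv (deriv (z t))) hsm₂
  have hz := fun t φ => (hasDerivAt_snd_of_contDiff hsm t φ).differentiableAt.hasDerivAt
  have hz₁ := fun t φ => (hasDerivAt_snd_of_contDiff (a := fun t => deriv (z t)) hsm₁ t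
    φ).differentiableAt.hasDerivAt
  have hz₂ := fun t φ => (hasDerivAt_snd_of_contDiff (a := fun t => deriv (deriv (z t))) hsm₂ t
    φ).differentiableAt.hasDerivAt
  set W : ℝ → ℝ → ℝ := fun t φ =>
    (z t φ).re * (deriv (z t) φ).im - (z t φ).im * (deriv (z t) φ).re with hW
  have hWφ : ∀ t, deriv (W t) = fun φ =>
      (z t φ).re * (deriv (deriv (z t)) φ).im - (z t φ).im * (deriv (deriv (z t)) φ).re := by
    intro t
    ext φ
    refine (((hz t φ).complex_re.fun_mul (hz₁ t φ).complex_im).fun_sub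
      ((hz t φ).complex_im.fun_mul (hz₁ t φ).complex_re)).deriv.trans ?_
    ring
  have hWφφ : ∀ t φ, deriv (deriv (W t)) φ =
      (deriv (z t) φ).re * (deriv (deriv (z t)) φ).im
        - (deriv (z t) φ).im * (deriv (deriv (z t)) φ).re
      + ((z t φ).re * (deriv (deriv (deriv (z t))) φ).im
        - (z t φ).im * (deriv (deriv (deriv (z t))) φ).re) := by
    intro t φ
    rw [hWφ]
    refine (((hz t φ).complex_re.fun_mul (hz₂ t φ).complex_im).fun_sub
      ((hz t φ).complex_im.fun_mul (hz₂ t φ).complex_re)).deriv.trans ?_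
    ring
  obtain ⟨C, hC⟩ := (isCompact_Icc.prod isCompact_Icc :
      IsCompact (Icc 0 t₀ ×ˢ Icc 0 (2 * π))).exists_bound_of_continuousOn
    (continuousOn_zerothCoeff ((n : ℝ) - 1)
      (Complex.continuous_re.comp hsm.continuous) (Complex.continuous_im.comp hsm.continuous)
      (Complex.continuous_re.comp hsm₁.continuous) (Complex.continuous_im.comp hsm₁.continuous)
      (Complex.continuous_re.comp hsm₂.continuous) (Complex.continuous_im.comp hsm₂.continuous)
      (Complex.continuous_re.comp hsm₃.continuous) (Complex.continuous_im.comp hsm₃.continuous)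
      (fun p hp => re_sq_add_im_sq_ne_zero (hreg _ (hsub _ hp.1) _))
      (fun p hp => re_sq_add_im_sq_ne_zero (hnz _ (hsub _ hp.1) _)))
  have hWsm : ContDiff ℝ (⊤ : ℕ∞) fun p : ℝ × ℝ => W p.1 p.2 :=
    ((Complex.reCLM.contDiff.comp hsm).mul (Complex.imCLM.contDiff.comp hsm₁)).sub
      ((Complex.imCLM.contDiff.comp hsm).mul (Complex.reCLM.contDiff.comp hsm₁))
  have hWt := fun t φ => (hasDerivAt_fst_of_contDiff hWsm t φ).differentiableAt.hasDerivAt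
  have hWper : ∀ t, Function.Periodic (W t) (2 * π) := by
    intro t φ
    have : deriv (z t) (φ + 2 * π) = deriv (z t) φ := by
      rw [← deriv_comp_add_const]
      simp only [hper]
    simp only [hW, hper, this]
  intro φ
  refine (ner_pos_iff (hnz _ ht₀ φ) (hreg _ ht₀ φ)).2 ?_
  refine pos_of_periodic_parabolic (W := W) (t₀ := t₀) (C := C + 1) two_pi_pos hWsm.continuous
    hWper hWt (fun φ => (ner_pos_iff (hnz _ h0T φ) (hreg _ h0T φ)).1 (hstar φ)) ?_ t₀
    ⟨ht₀.1, le_rfl⟩ φ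
  intro t ht φ hφ hpos hcrit hconv
  have htT := hsub t ⟨ht.1.le, ht.2⟩
  rw [hWφ] at hcrit
  rw [hWφφ] at hconv
  have hev := (hasDerivAt_time_of_flow hsm (hreg t htT) (hnz t htT) (hflow t htT) hcrit).deriv
  have hbd := (abs_le.1 (hC (t, φ) ⟨⟨ht.1.le, ht.2⟩, hφ⟩)).1
  have hdiff := div_nonneg hconv
    (by positivity : 0 ≤ (deriv (z t) φ).re ^ 2 + (deriv (z t) φ).im ^ 2)
  have hmul := mul_le_mul_of_nonneg_right hbd hpos.le
  refine lt_of_lt_of_eq ?_ hev.symm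
  simp only [Function.comp_apply] at hmul
  simp only [hW] at hmul hpos ⊢
  linarith
end
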